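/- Peter–Weyl decomposition for a finite group, part (i): the ℂ-linear map Φ : ⊕_{ρ∈Irr} (V_ρ* ⊗ V_ρ) → Map(G, ℂ), defined on the summand labelled ρ by Φ(η ⊗ v)(g) = η(ρ(g)v), is a ℂ-linear isomorphism onto the space of all functions G → ℂ, and it is equivariant for the G×G-actions: the pair (a,b) ∈ G×G acts on the summand labelled ρ by ρ*(a) ⊗ ρ(b) and on functions F : G → ℂ by ((a,b)·F)(g) = F(a⁻¹·g·b). -/

import Mathlib

/-!
STATEMENT 0: Peter–Weyl decomposition for a finite group, part (i).

`Irr` is modelled by an abstract index type `ι`, a family of finite-dimensional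
complex Hilbert spaces `V i` and unitary representations `ρ i`, which are
irreducible, pairwise non-isomorphic, and such that every irreducible unitary
finite-dimensional representation of `G` is isomorphic to some `ρ i`.
-/

open scoped TensorProduct ComplexInnerProductSpace DirectSum

/-- The Peter–Weyl map `⊕_{ρ ∈ Irr} (V_ρ* ⊗ V_ρ) → Map(G, ℂ)`, sending `η ⊗ v` in the
summand labelled `i` to the representation function `g ↦ η (ρ i g v)`. -/
noncomputable def peterWeylMap {G : Type*} [Group G] {ι : Type*} [DecidableEq ι]
    (V : ι → Type*) [∀ i, NormedAddCommGroup (V i)] [∀ i, InnerProductSpace ℂ (V i)]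
    (ρ : ∀ i, Representation ℂ G (V i)) :
    (⨁ i, Module.Dual ℂ (V i) ⊗[ℂ] V i) →ₗ[ℂ] (G → ℂ) :=
  DirectSum.toModule ℂ ι (G → ℂ) fun i =>
    TensorProduct.lift
      (LinearMap.mk₂ ℂ (fun η v g => η (ρ i g v))
        (fun η η' v => by funext g; simp)
        (fun c η v => by funext g; simp)
        (fun η v w => by funext g; simp)
        (fun c η v => by funext g; simp))


section PWHelpers

universe pw

variable {G : Type*} [Group G]

theorem pw_of {ι : Type*} [DecidableEq ι]
    (V : ι → Type*) [∀ i, NormedAddCommGroup (V i)] [∀ i, InnerProductSpace ℂ (V i)]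
    (ρ : ∀ i, Representation ℂ G (V i)) (i : ι) (η : Module.Dual ℂ (V i)) (v : V i) (g : G) :
    peterWeylMap V ρ (DirectSum.of (fun i => Module.Dual ℂ (V i) ⊗[ℂ] V i) i (η ⊗ₜ[ℂ] v)) g
      = η (ρ i g v) := by
  have : peterWeylMap V ρ (DirectSum.of (fun i => Module.Dual ℂ (V i) ⊗[ℂ] V i) i (η ⊗ₜ[ℂ] v))
      = fun g => η (ρ i g v) := by
    unfold peterWeylMap
    erw [DirectSum.toModule_lof]
    rfl
  rw [this]

/-- Restriction of a representation to an invariant subspace. -/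
noncomputable def pwRestrict {W : Type*} [AddCommGroup W] [Module ℂ W]
    (σ : Representation ℂ G W) (U : Submodule ℂ W) (hU : ∀ g : G, ∀ v ∈ U, σ g v ∈ U) :
    Representation ℂ G U where
  toFun g := (σ g).restrict (hU g)
  map_one' := by ext x; simp
  map_mul' a b := by ext x; simp

theorem pw_restrict_coe {W : Type*} [AddCommGroup W] [Module ℂ W]
    (σ : Representation ℂ G W) (U : Submodule ℂ W) (hU : ∀ g : G, ∀ v ∈ U, σ g v ∈ U)
    (g : G) (x : U) : (pwRestrict σ U hU g x : W) = σ g x := rfl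

/-- Matrix coefficients of every unitary representation lie in a subspace that contains
those of the irreducible ones. -/
theorem pw_coeff_mem (M : Submodule ℂ (G → ℂ))
    (hM : ∀ (W : Type pw) [NormedAddCommGroup W] [InnerProductSpace ℂ W]
      [FiniteDimensional ℂ W] (σ : Representation ℂ G W),
      (∀ (g : G) (v w : W), ⟪σ g v, σ g w⟫ = ⟪v, w⟫) →
      Nontrivial W →
      (∀ U : Submodule ℂ W, (∀ g : G, ∀ v ∈ U, σ g v ∈ U) → U = ⊥ ∨ U = ⊤) →
      ∀ (l : Module.Dual ℂ W) (v : W), (fun g => l (σ g v)) ∈ M) (n : ℕ) :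
    ∀ (W : Type pw) [NormedAddCommGroup W] [InnerProductSpace ℂ W]
      [FiniteDimensional ℂ W] (σ : Representation ℂ G W),
      (∀ (g : G) (v w : W), ⟪σ g v, σ g w⟫ = ⟪v, w⟫) →
      Module.finrank ℂ W = n →
      ∀ (l : Module.Dual ℂ W) (v : W), (fun g => l (σ g v)) ∈ M := by
  induction n using Nat.strong_induction_on with
  | _ n ih =>
  intro W _ _ _ σ hσ hn l v
  rcases subsingleton_or_nontrivial W with hs | hnt
  · have : (fun g => l (σ g v)) = 0 := by
      funext g
      rw [Subsingleton.elim (σ g v) 0]; simp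
    rw [this]; exact M.zero_mem
  by_cases h : ∀ U : Submodule ℂ W, (∀ g : G, ∀ v ∈ U, σ g v ∈ U) → U = ⊥ ∨ U = ⊤
  · exact hM W σ hσ hnt h l v
  push Not at h
  obtain ⟨U, hU, hb, ht⟩ := h
  have hU' : ∀ g : G, ∀ v ∈ Uᗮ, σ g v ∈ Uᗮ := by
    intro g v hv
    rw [Submodule.mem_orthogonal] at hv ⊢
    intro u hu
    have h1 := hv (σ g⁻¹ u) (hU _ _ hu)
    rw [← hσ g] at h1
    rwa [← Module.End.mul_apply, ← map_mul, mul_inv_cancel, map_one, Module.End.one_apply] at h1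
  have hsum := Submodule.finrank_add_finrank_orthogonal U
  have hpos : 0 < Module.finrank ℂ U := by
    rw [Module.finrank_pos_iff]; exact Submodule.nontrivial_iff_ne_bot.2 hb
  have hlt : Module.finrank ℂ U < Module.finrank ℂ W := Submodule.finrank_lt ht
  obtain ⟨u, hu, u', hu', rfl⟩ := U.exists_add_mem_mem_orthogonal v
  have e1 := ih (Module.finrank ℂ U) (by omega) U (pwRestrict σ U hU)
    (fun g v w => hσ g v w) rfl (l ∘ₗ U.subtype) ⟨u, hu⟩
  have e2 := ih (Module.finrank ℂ Uᗮ) (by omega) (Uᗮ : Submodule ℂ W) (pwRestrict σ Uᗮ hU')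
    (fun g v w => hσ g v w) rfl (l ∘ₗ Uᗮ.subtype) ⟨u', hu'⟩
  convert M.add_mem e1 e2 using 1
  funext g
  simp [pw_restrict_coe]

/-- The right regular representation on a Euclidean space indexed by a type equivalent to `G`. -/
noncomputable def pwRegular {κ : Type*} [Fintype κ] (e : κ ≃ G) :
    Representation ℂ G (EuclideanSpace ℂ κ) where
  toFun g :=
    { toFun := fun F => WithLp.toLp 2 (fun k => F (e.symm (e k * g)))
      map_add' := fun _ _ => by ext; simp
      map_smul' := fun _ _ => by ext; simp }
  map_one' := by ext; simp
  map_mul' a b := by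
    apply LinearMap.ext; intro F; ext k; simp [mul_assoc]

theorem pw_regular_apply {κ : Type*} [Fintype κ] (e : κ ≃ G) (g : G) (F : EuclideanSpace ℂ κ)
    (k : κ) : pwRegular e g F k = F (e.symm (e k * g)) := rfl

theorem pw_regular_unitary {κ : Type*} [Fintype κ] (e : κ ≃ G) (g : G)
    (v w : EuclideanSpace ℂ κ) : ⟪pwRegular e g v, pwRegular e g w⟫ = ⟪v, w⟫ := by
  rw [PiLp.inner_apply, PiLp.inner_apply]
  simp only [pw_regular_apply]
  exact Equiv.sum_comp ((e.trans (Equiv.mulRight g)).trans e.symm) (fun k => ⟪v k, w k⟫)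

section Schur
variable [Fintype G] {V W : Type*} [AddCommGroup V] [Module ℂ V] [AddCommGroup W] [Module ℂ W]
  (ρ : Representation ℂ G V) (σ : Representation ℂ G W)

/-- Averaging a linear map. -/
noncomputable def pwAvg (T : V →ₗ[ℂ] W) : V →ₗ[ℂ] W :=
  ∑ g : G, σ g ∘ₗ T ∘ₗ ρ g⁻¹

theorem pw_avg_apply (T : V →ₗ[ℂ] W) (v : V) :
    pwAvg ρ σ T v = ∑ g : G, σ g (T (ρ g⁻¹ v)) := by
  simp [pwAvg, LinearMap.sum_apply]

theorem pw_avg_equivariant (T : V →ₗ[ℂ] W) (h : G) (v : V) :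
    pwAvg ρ σ T (ρ h v) = σ h (pwAvg ρ σ T v) := by
  rw [pw_avg_apply, pw_avg_apply, map_sum, ← Equiv.sum_comp (Equiv.mulLeft h)]
  refine Finset.sum_congr rfl fun g _ => ?_
  simp only [Equiv.coe_mulLeft, mul_inv_rev, map_mul, Module.End.mul_apply]
  congr 3
  rw [← Module.End.mul_apply (ρ h⁻¹), ← Module.End.mul_apply, ← map_mul, inv_mul_cancel]
  simp

theorem pw_schur_ne (hV : ∀ U : Submodule ℂ V, (∀ g : G, ∀ v ∈ U, ρ g v ∈ U) → U = ⊥ ∨ U = ⊤)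
    (hW : ∀ U : Submodule ℂ W, (∀ g : G, ∀ v ∈ U, σ g v ∈ U) → U = ⊥ ∨ U = ⊤)
    (hne : ¬∃ e : V ≃ₗ[ℂ] W, ∀ (g : G) (v : V), e (ρ g v) = σ g (e v))
    (T : V →ₗ[ℂ] W) (hT : ∀ g v, T (ρ g v) = σ g (T v)) : T = 0 := by
  rcases hV (LinearMap.ker T) (fun g v hv => by
    rw [LinearMap.mem_ker] at hv ⊢; rw [hT, hv, map_zero]) with h1 | h1
  · rcases hW (LinearMap.range T) (fun g v hv => by
      obtain ⟨x, rfl⟩ := hv; exact ⟨ρ g x, hT g x⟩) with h2 | h2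
    · exact LinearMap.range_eq_bot.1 h2
    · exact absurd ⟨LinearEquiv.ofBijective T ⟨LinearMap.ker_eq_bot.1 h1,
        LinearMap.range_eq_top.1 h2⟩, hT⟩ hne
  · exact LinearMap.ker_eq_top.1 h1

theorem pw_schur_eq [Nontrivial V] [FiniteDimensional ℂ V]
    (hV : ∀ U : Submodule ℂ V, (∀ g : G, ∀ v ∈ U, ρ g v ∈ U) → U = ⊥ ∨ U = ⊤)
    (T : V →ₗ[ℂ] V) (hT : ∀ g v, T (ρ g v) = ρ g (T v)) : ∃ c : ℂ, ∀ v, T v = c • v := by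
  obtain ⟨c, hc⟩ := Module.End.exists_eigenvalue T
  refine ⟨c, fun v => ?_⟩
  rcases hV (Module.End.eigenspace T c) (fun g v hv => by
    rw [Module.End.mem_eigenspace_iff] at hv ⊢; rw [hT, hv, map_smul]) with h1 | h1
  · exact absurd h1 hc
  · exact Module.End.mem_eigenspace_iff.1 (h1 ▸ Submodule.mem_top)

theorem pw_trace_avg [FiniteDimensional ℂ V] (T : V →ₗ[ℂ] V) :
    LinearMap.trace ℂ V (pwAvg ρ ρ T) = Fintype.card G * LinearMap.trace ℂ V T := by
  have : ∀ g : G, LinearMap.trace ℂ V (ρ g ∘ₗ T ∘ₗ ρ g⁻¹) = LinearMap.trace ℂ V T := by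
    intro g
    change LinearMap.trace ℂ V (ρ g * (T * ρ g⁻¹)) = _
    rw [LinearMap.trace_mul_comm, mul_assoc, ← map_mul, inv_mul_cancel, map_one, mul_one]
  simp [pwAvg, map_sum, this]

theorem pw_orth_eq [Nontrivial V] [FiniteDimensional ℂ V]
    (hV : ∀ U : Submodule ℂ V, (∀ g : G, ∀ v ∈ U, ρ g v ∈ U) → U = ⊥ ∨ U = ⊤)
    (η ξ : Module.Dual ℂ V) (v w : V) :
    (Module.finrank ℂ V : ℂ) * ∑ g : G, η (ρ g v) * ξ (ρ g⁻¹ w)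
      = Fintype.card G * (η w * ξ v) := by
  set T : V →ₗ[ℂ] V := dualTensorHom ℂ V V (ξ ⊗ₜ v) with hTd
  obtain ⟨c, hc⟩ := pw_schur_eq ρ hV (pwAvg ρ ρ T) (pw_avg_equivariant ρ ρ T)
  have h1 : pwAvg ρ ρ T = c • LinearMap.id := LinearMap.ext hc
  have h2 := pw_trace_avg ρ T
  have h3 : LinearMap.trace ℂ V T = ξ v := by
    rw [hTd, LinearMap.trace_eq_contract_apply, contractLeft_apply]
  rw [h1, h3, map_smul, LinearMap.trace_id, smul_eq_mul] at h2
  have h4 : ∑ g : G, η (ρ g v) * ξ (ρ g⁻¹ w) = c * η w := by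
    have := congrArg η (hc w)
    rw [pw_avg_apply, map_sum, map_smul, smul_eq_mul] at this
    rw [← this]
    refine Finset.sum_congr rfl fun g _ => ?_
    simp [hTd, dualTensorHom_apply, mul_comm]
  rw [h4]
  linear_combination η w * h2

theorem pw_orth_ne
    (hV : ∀ U : Submodule ℂ V, (∀ g : G, ∀ v ∈ U, ρ g v ∈ U) → U = ⊥ ∨ U = ⊤)
    (hW : ∀ U : Submodule ℂ W, (∀ g : G, ∀ v ∈ U, σ g v ∈ U) → U = ⊥ ∨ U = ⊤)
    (hne : ¬∃ e : V ≃ₗ[ℂ] W, ∀ (g : G) (v : V), e (ρ g v) = σ g (e v))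
    (η : Module.Dual ℂ W) (ξ : Module.Dual ℂ V) (v : W) (w : V) :
    ∑ g : G, η (σ g v) * ξ (ρ g⁻¹ w) = 0 := by
  set T : V →ₗ[ℂ] W := dualTensorHom ℂ V W (ξ ⊗ₜ v) with hTd
  have h1 := pw_schur_ne ρ σ hV hW hne (pwAvg ρ σ T) (pw_avg_equivariant ρ σ T)
  have := congrArg η (LinearMap.congr_fun h1 w)
  rw [pw_avg_apply, map_sum, LinearMap.zero_apply, map_zero] at this
  rw [← this]
  refine Finset.sum_congr rfl fun g _ => ?_
  simp [hTd, dualTensorHom_apply, mul_comm]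

end Schur

end PWHelpers

/-- **Peter–Weyl decomposition, part (i)** for a finite group `G`: the map
`Φ : ⊕_{ρ∈Irr} (V_ρ* ⊗ V_ρ) → Map(G, ℂ)`, `Φ(η ⊗ v)(g) = η(ρ(g)v)`, is a ℂ-linear
isomorphism onto the space of all functions `G → ℂ`, and it is equivariant for the
`G × G`-actions: `(a, b)` acts on the summand labelled `ρ` by `ρ*(a) ⊗ ρ(b)`
(where `ρ*(a) η = η ∘ ρ(a⁻¹)`) and on functions by `((a,b)·F)(g) = F(a⁻¹ · g · b)`. -/
theorem peter_weyl_decomposition_part_one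
    {G : Type*} [Group G] [Fintype G] {ι : Type*} [DecidableEq ι]
    (V : ι → Type*) [∀ i, NormedAddCommGroup (V i)] [∀ i, InnerProductSpace ℂ (V i)]
    [∀ i, FiniteDimensional ℂ (V i)]
    (ρ : ∀ i, Representation ℂ G (V i))
    -- each `ρ i` is unitary
    (hunitary : ∀ (i : ι) (g : G) (v w : V i), ⟪ρ i g v, ρ i g w⟫ = ⟪v, w⟫)
    -- each `ρ i` is irreducible
    (hirr : ∀ i, Nontrivial (V i) ∧
      ∀ U : Submodule ℂ (V i), (∀ g : G, ∀ v ∈ U, ρ i g v ∈ U) → U = ⊥ ∨ U = ⊤)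
    -- the `ρ i` are pairwise non-isomorphic
    (hpairwise : ∀ i j, i ≠ j →
      ¬∃ e : V i ≃ₗ[ℂ] V j, ∀ (g : G) (v : V i), e (ρ i g v) = ρ j g (e v))
    -- every irreducible unitary finite-dimensional representation of `G` is
    -- isomorphic to some `ρ i`
    (hcomplete : ∀ (W : Type*) [NormedAddCommGroup W] [InnerProductSpace ℂ W]
      [FiniteDimensional ℂ W] (σ : Representation ℂ G W),
      (∀ (g : G) (v w : W), ⟪σ g v, σ g w⟫ = ⟪v, w⟫) →
      Nontrivial W →
      (∀ U : Submodule ℂ W, (∀ g : G, ∀ v ∈ U, σ g v ∈ U) → U = ⊥ ∨ U = ⊤) →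
      ∃ i, ∃ e : W ≃ₗ[ℂ] V i, ∀ (g : G) (v : W), e (σ g v) = ρ i g (e v)) :
    Function.Bijective (peterWeylMap V ρ) ∧
    ∀ (a b : G) (i : ι) (η : Module.Dual ℂ (V i)) (v : V i) (g : G),
      peterWeylMap V ρ
        (DirectSum.of (fun i => Module.Dual ℂ (V i) ⊗[ℂ] V i) i
          (((ρ i a⁻¹).dualMap η) ⊗ₜ[ℂ] (ρ i b v))) g
        =
      peterWeylMap V ρ
        (DirectSum.of (fun i => Module.Dual ℂ (V i) ⊗[ℂ] V i) i (η ⊗ₜ[ℂ] v))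
        (a⁻¹ * g * b) := by
  classical
  refine ⟨⟨?_, ?_⟩, ?_⟩
  · rw [injective_iff_map_eq_zero]
    intro x hx
    refine DFinsupp.ext fun i => ?_
    haveI := (hirr i).1
    have key : ∀ (ξ : Module.Dual ℂ (V i)) (w : V i),
        ξ (dualTensorHom ℂ (V i) (V i) (x i) w) = 0 := by
      intro ξ w
      have hgen : ∀ y : (⨁ i, Module.Dual ℂ (V i) ⊗[ℂ] V i),
          (Module.finrank ℂ (V i) : ℂ) * ∑ g : G, peterWeylMap V ρ y g * ξ (ρ i g⁻¹ w)
            = Fintype.card G * ξ (dualTensorHom ℂ (V i) (V i) (y i) w) := by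
        intro y
        induction y using DirectSum.induction_on with
        | zero => simp
        | add a b ha hb =>
          simp only [map_add, Pi.add_apply, add_mul, Finset.sum_add_distrib, mul_add,
            DirectSum.add_apply, LinearMap.add_apply] at ha hb ⊢
          rw [ha, hb]
        | of j t =>
          induction t using TensorProduct.induction_on with
          | zero => simp
          | add a b ha hb =>
            simp only [map_add, Pi.add_apply, add_mul, Finset.sum_add_distrib, mul_add,
              DirectSum.add_apply, LinearMap.add_apply] at ha hb ⊢
            rw [ha, hb]
          | tmul η v =>
            simp only [pw_of]
            by_cases hij : i = j
            · subst hij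
              rw [DirectSum.of_eq_same, pw_orth_eq (ρ i) (hirr i).2]
              simp [dualTensorHom_apply]
            · rw [DirectSum.of_eq_of_ne _ _ _ hij,
                pw_orth_ne (ρ i) (ρ j) (hirr i).2 (hirr j).2 (hpairwise i j hij)]
              simp
      have h := hgen x
      rw [hx] at h
      simpa using h.symm
    have h0 : dualTensorHom ℂ (V i) (V i) (x i) = 0 := by
      ext w
      exact (Module.forall_dual_apply_eq_zero_iff ℂ _).1 (fun ξ => key ξ w)
    have := (dualTensorHomEquiv ℂ (V i) (V i)).injective
      (a₁ := x i) (a₂ := 0) (by simpa using h0)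
    simpa using this
  · intro F
    let e : ULift (Fin (Fintype.card G)) ≃ G := Equiv.ulift.trans (Fintype.equivFin G).symm
    have h := pw_coeff_mem (LinearMap.range (peterWeylMap V ρ)) (by
      intro W _ _ _ σ h1 h2 h3 l v
      obtain ⟨i, f, hf⟩ := hcomplete W σ h1 h2 h3
      refine ⟨DirectSum.of (fun i => Module.Dual ℂ (V i) ⊗[ℂ] V i) i
        ((l ∘ₗ f.symm.toLinearMap) ⊗ₜ[ℂ] f v), ?_⟩
      funext g
      rw [pw_of, ← hf]
      simp) _ (EuclideanSpace ℂ (ULift (Fin (Fintype.card G)))) (pwRegular e)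
      (pw_regular_unitary e) rfl
      { toFun := fun F => F (e.symm 1), map_add' := fun _ _ => rfl, map_smul' := fun _ _ => rfl }
      (WithLp.toLp 2 (fun k => F (e k)))
    obtain ⟨x, hx⟩ := h
    refine ⟨x, hx.trans ?_⟩
    funext g
    change F (e (e.symm (e (e.symm 1) * g))) = F g
    simp only [Equiv.apply_symm_apply, one_mul]
  · intro a b i η v g
    rw [pw_of, pw_of]
    simp [map_mul]
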